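/- Let x, u, θ : ℝ≥0 × ℝ → ℝ be smooth functions with x_s(τ,s) = cos θ(τ,s) and u_s(τ,s) = sin θ(τ,s) everywhere, such that (x,u) solves the parametrized form of the short pulse equation x_s(u_{τs} x_s − x_{τs} u_s) = u·x_s·(x_s² + u_s²) + (x_τ + u²/2)(u_{ss} x_s − x_{ss} u_s), and such that x_τ(τ,s) + (u(τ,s))²/2 = 0 and cos θ(τ,s) ≠ 0 for all τ ≥ 0, s ∈ ℝ. Then θ is a solution of the sine-Gordon equation θ_{τs} = sin θ. -/

import Mathlib

open Real

/-- Partial derivative in the first (time) variable `τ`. -/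
noncomputable def pτ (f : ℝ → ℝ → ℝ) (t s : ℝ) : ℝ := deriv (fun τ => f τ s) t

/-- Partial derivative in the second (space) variable `s`. -/
noncomputable def ps (f : ℝ → ℝ → ℝ) (t s : ℝ) : ℝ := deriv (fun σ => f t σ) s

/-- The parametrized form of the short pulse equation at `(τ, s)`. -/
def ParamSPE (x u : ℝ → ℝ → ℝ) (τ s : ℝ) : Prop :=
  ps x τ s * (pτ (ps u) τ s * ps x τ s - pτ (ps x) τ s * ps u τ s)
    = u τ s * ps x τ s * ((ps x τ s)^2 + (ps u τ s)^2)
      + (pτ x τ s + (u τ s)^2 / 2)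
        * (ps (ps u) τ s * ps x τ s - ps (ps x) τ s * ps u τ s)

lemma aux_ps {f : ℝ → ℝ → ℝ} (hf : ContDiff ℝ (⊤ : ℕ∞) (Function.uncurry f)) (t s : ℝ) :
    HasDerivAt (fun σ => f t σ) (fderiv ℝ (Function.uncurry f) (t, s) (0, 1)) s := by
  have h1 : HasFDerivAt (Function.uncurry f) (fderiv ℝ (Function.uncurry f) (t, s)) (t, s) :=
    (hf.differentiable (by simp) _).hasFDerivAt
  have h2 : HasDerivAt (fun σ : ℝ => (t, σ)) ((0 : ℝ), (1 : ℝ)) s :=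
    (hasDerivAt_const s t).prodMk (hasDerivAt_id s)
  exact HasFDerivAt.comp_hasDerivAt (f := fun σ : ℝ => (t, σ)) s h1 h2

lemma aux_pt {f : ℝ → ℝ → ℝ} (hf : ContDiff ℝ (⊤ : ℕ∞) (Function.uncurry f)) (t s : ℝ) :
    HasDerivAt (fun τ => f τ s) (fderiv ℝ (Function.uncurry f) (t, s) (1, 0)) t := by
  have h1 : HasFDerivAt (Function.uncurry f) (fderiv ℝ (Function.uncurry f) (t, s)) (t, s) :=
    (hf.differentiable (by simp) _).hasFDerivAt
  have h2 : HasDerivAt (fun τ : ℝ => (τ, s)) ((1 : ℝ), (0 : ℝ)) t :=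
    (hasDerivAt_id t).prodMk (hasDerivAt_const t s)
  exact HasFDerivAt.comp_hasDerivAt (f := fun τ : ℝ => (τ, s)) t h1 h2

lemma aux_ps_eq {f : ℝ → ℝ → ℝ} (hf : ContDiff ℝ (⊤ : ℕ∞) (Function.uncurry f)) :
    Function.uncurry (ps f) = fun p => fderiv ℝ (Function.uncurry f) p (0, 1) := by
  funext ⟨t, s⟩
  exact (aux_ps hf t s).deriv

lemma aux_pt_eq {f : ℝ → ℝ → ℝ} (hf : ContDiff ℝ (⊤ : ℕ∞) (Function.uncurry f)) :
    Function.uncurry (pτ f) = fun p => fderiv ℝ (Function.uncurry f) p (1, 0) := by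
  funext ⟨t, s⟩
  exact (aux_pt hf t s).deriv

lemma aux_fd {f : ℝ → ℝ → ℝ} (hf : ContDiff ℝ (⊤ : ℕ∞) (Function.uncurry f)) :
    ContDiff ℝ (⊤ : ℕ∞) (fderiv ℝ (Function.uncurry f)) :=
  hf.fderiv_right (by simp)

lemma aux_ps_smooth {f : ℝ → ℝ → ℝ} (hf : ContDiff ℝ (⊤ : ℕ∞) (Function.uncurry f)) :
    ContDiff ℝ (⊤ : ℕ∞) (Function.uncurry (ps f)) := by
  rw [aux_ps_eq hf]
  exact (aux_fd hf).clm_apply contDiff_const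

lemma aux_pt_smooth {f : ℝ → ℝ → ℝ} (hf : ContDiff ℝ (⊤ : ℕ∞) (Function.uncurry f)) :
    ContDiff ℝ (⊤ : ℕ∞) (Function.uncurry (pτ f)) := by
  rw [aux_pt_eq hf]
  exact (aux_fd hf).clm_apply contDiff_const

lemma aux_symm {f : ℝ → ℝ → ℝ} (hf : ContDiff ℝ (⊤ : ℕ∞) (Function.uncurry f)) (t s : ℝ) :
    pτ (ps f) t s = ps (pτ f) t s := by
  have hd := (aux_fd hf).differentiable (by simp) (t, s)
  have e1 : pτ (ps f) t s = fderiv ℝ (fderiv ℝ (Function.uncurry f)) (t, s) (1, 0) (0, 1) := by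
    rw [pτ, (aux_pt (aux_ps_smooth hf) t s).deriv, aux_ps_eq hf,
      fderiv_clm_apply hd (differentiableAt_const _)]
    simp
  have e2 : ps (pτ f) t s = fderiv ℝ (fderiv ℝ (Function.uncurry f)) (t, s) (0, 1) (1, 0) := by
    rw [ps, (aux_ps (aux_pt_smooth hf) t s).deriv, aux_pt_eq hf,
      fderiv_clm_apply hd (differentiableAt_const _)]
    simp
  rw [e1, e2]
  exact (hf.contDiffAt.isSymmSndFDerivAt (by simpa using (by exact_mod_cast le_top : ((2:ℕ∞) : WithTop ℕ∞) ≤ ((⊤:ℕ∞) : WithTop ℕ∞)))) _ _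

lemma aux_right {f g : ℝ → ℝ} {a b t : ℝ} (ht : 0 ≤ t) (hf : HasDerivAt f a t)
    (hg : HasDerivAt g b t) (h : ∀ r ≥ (0:ℝ), f r = g r) : a = b := by
  have h1 : HasDerivWithinAt f a (Set.Ici t) t := hf.hasDerivWithinAt
  have h2 : HasDerivWithinAt f b (Set.Ici t) t :=
    hg.hasDerivWithinAt.congr (fun r hr => h r (ht.trans hr)) (h t ht)
  exact (uniqueDiffWithinAt_Ici t).eq_deriv _ h1 h2

/-- If smooth `x, u, θ` satisfy `x_s = cos θ`, `u_s = sin θ`, `(x,u)` solves the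
parametrized short pulse equation, `x_τ + u²/2 = 0`, and `cos θ ≠ 0` everywhere, then
`θ` solves the sine-Gordon equation `θ_{τs} = sin θ`. -/
theorem paramSPE_to_sineGordon
    (x u θ : ℝ → ℝ → ℝ)
    (hx : ContDiff ℝ (⊤ : ℕ∞) (Function.uncurry x))
    (hu : ContDiff ℝ (⊤ : ℕ∞) (Function.uncurry u))
    (hθ : ContDiff ℝ (⊤ : ℕ∞) (Function.uncurry θ))
    (hxs : ∀ τ ≥ (0:ℝ), ∀ s : ℝ, ps x τ s = Real.cos (θ τ s))
    (hus : ∀ τ ≥ (0:ℝ), ∀ s : ℝ, ps u τ s = Real.sin (θ τ s))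
    (hspe : ∀ τ ≥ (0:ℝ), ∀ s : ℝ, ParamSPE x u τ s)
    (hconstr : ∀ τ ≥ (0:ℝ), ∀ s : ℝ, pτ x τ s + (u τ s)^2 / 2 = 0)
    (hcos : ∀ τ ≥ (0:ℝ), ∀ s : ℝ, Real.cos (θ τ s) ≠ 0) :
    ∀ τ ≥ (0:ℝ), ∀ s : ℝ, pτ (ps θ) τ s = Real.sin (θ τ s) := by
  intro τ hτ s
  have key : ∀ σ, pτ θ τ σ = u τ σ := by
    intro σ
    have ht : HasDerivAt (fun r => θ r σ) (pτ θ τ σ) τ :=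
      (aux_pt hθ τ σ).differentiableAt.hasDerivAt
    have h1 : pτ (ps u) τ σ = Real.cos (θ τ σ) * pτ θ τ σ :=
      aux_right hτ (aux_pt (aux_ps_smooth hu) τ σ).differentiableAt.hasDerivAt ht.sin
        (fun r hr => hus r hr σ)
    have h2 : pτ (ps x) τ σ = -Real.sin (θ τ σ) * pτ θ τ σ :=
      aux_right hτ (aux_pt (aux_ps_smooth hx) τ σ).differentiableAt.hasDerivAt ht.cos
        (fun r hr => hxs r hr σ)
    have h := hspe τ hτ σ
    rw [ParamSPE, hconstr τ hτ σ, h1, h2, hxs τ hτ σ, hus τ hτ σ] at h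
    have hsc := Real.sin_sq_add_cos_sq (θ τ σ)
    apply mul_left_cancel₀ (hcos τ hτ σ)
    linear_combination h - (Real.cos (θ τ σ)) * (pτ θ τ σ - u τ σ) * hsc
  rw [aux_symm hθ, ← hus τ hτ s]
  simp only [ps, key]
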